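/- Let p ≥ 5 be a prime and let D be a nontrivial regular (v,k,λ,μ)-partial difference set in an Abelian group of order v = 8p^3 with Δ = (λ−μ)^2 + 4(k−μ) = 16p^2 and k ≤ v/2 = 4p^3. Then 2k ≤ 8p^2 + 6p − 1 (equivalently, k ≤ 4p^2 + 3p − 1/2). -/

import Mathlib

variable {G : Type*} [CommGroup G] [DecidableEq G] [Fintype G]

/-- The number of representations of `g` as `d₁ * d₂⁻¹` with `d₁, d₂ ∈ D`, `d₁ ≠ d₂`. -/
def pdsReps (D : Finset G) (g : G) : ℕ :=
  ((D ×ˢ D).filter (fun x => x.1 ≠ x.2 ∧ x.1 * x.2⁻¹ = g)).card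

/-- `D` is a `(v,k,λ,μ)`-partial difference set in `G`. -/
def IsPDS (D : Finset G) (v k l m : ℕ) : Prop :=
  Fintype.card G = v ∧ D.card = k ∧
  (∀ g : G, g ≠ 1 → g ∈ D → pdsReps D g = l) ∧
  (∀ g : G, g ≠ 1 → g ∉ D → pdsReps D g = m)

/-- `D` is regular: closed under inverses and not containing the identity. -/
def IsRegularPDS (D : Finset G) : Prop :=
  (∀ d ∈ D, d⁻¹ ∈ D) ∧ (1 : G) ∉ D

/-- A regular PDS is trivial if `D ∪ {e}` or `G \ D` is a subgroup. -/
def IsTrivialPDS (D : Finset G) : Prop :=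
  (∃ H : Subgroup G, (H : Set G) = ↑D ∪ {1}) ∨
  (∃ H : Subgroup G, (H : Set G) = (↑D : Set G)ᶜ)

/-- Counting ordered pairs of distinct elements of a regular partial difference set. -/
theorem IsPDS.card_mul_pred {G : Type*} [CommGroup G] [DecidableEq G] [Fintype G]
    {D : Finset G} {v k l m : ℕ} (hPDS : IsPDS D v k l m) (h1 : (1 : G) ∉ D) :
    (k : ℤ) * (k - 1) = l * k + m * (v - 1 - k) := by
  obtain ⟨hv, hk, hl, hm⟩ := hPDS
  have hone : pdsReps D 1 = 0 := by
    rw [pdsReps, Finset.card_eq_zero, Finset.filter_eq_empty_iff]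
    rintro x - ⟨hne, he⟩
    exact hne (mul_inv_eq_one.mp he)
  have htotal : D.offDiag.card = ∑ g : G, pdsReps D g := by
    rw [Finset.card_eq_sum_card_fiberwise (f := fun x : G × G => x.1 * x.2⁻¹)
      (t := Finset.univ) (by simp)]
    refine Finset.sum_congr rfl fun g _ => ?_
    rw [pdsReps]
    congr 1
    ext x
    simp [Finset.mem_offDiag, and_assoc]
  have hin : ∑ g ∈ D, pdsReps D g = k * l := by
    rw [Finset.sum_congr rfl fun g hg => hl g (fun h => h1 (h ▸ hg)) hg]
    simp [hk]
  have hout : ∑ g ∈ Dᶜ, pdsReps D g + m = Dᶜ.card * m := by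
    have hmem : (1 : G) ∈ Dᶜ := by simpa using h1
    rw [← Finset.add_sum_erase _ _ hmem, hone, Finset.sum_congr rfl fun g hg =>
      hm g (Finset.ne_of_mem_erase hg) (by simpa using Finset.mem_of_mem_erase hg),
      Finset.sum_const, smul_eq_mul, ← Finset.card_erase_add_one hmem]
    ring
  have hcompl := Finset.card_add_card_compl D
  rw [← Finset.sum_add_sum_compl D, hin, Finset.offDiag_card, hk] at htotal
  have hkk : k ≤ k * k := Nat.le_mul_self k
  rw [hk, hv] at hcompl
  zify [hkk] at htotal hout hcompl
  rw [← hcompl]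
  linear_combination htotal + hout

/-- The integrality conditions on the eigenvalues of a partial difference set with `v = 8p³` and
`Δ = 16p²`, where `λ - μ = 2b`: the number `(k - b) / (2p)` is `±1` modulo `2p`. -/
theorem exists_eq_of_eigenvalue_eq {p : ℕ} (hp : p.Prime) (hp2 : p ≠ 2) {x m : ℤ}
    (h : x ^ 2 = 4 * p ^ 2 + 8 * p ^ 3 * m) :
    ∃ t e : ℤ, (e = 1 ∨ e = -1) ∧ x = 2 * p * (2 * p * t + e) := by
  have hp0 : (p : ℤ) ≠ 0 := by exact_mod_cast hp.ne_zero
  have hpp : Prime (p : ℤ) := Nat.prime_iff_prime_int.mp hp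
  have hpodd : Odd (p : ℤ) := by exact_mod_cast hp.odd_of_ne_two hp2
  obtain ⟨y, rfl⟩ : (2 * p : ℤ) ∣ x :=
    (Int.pow_dvd_pow_iff two_ne_zero).mp ⟨1 + 2 * p * m, by rw [h]; ring⟩
  have hy : y ^ 2 = 1 + 2 * p * m := by
    refine mul_left_cancel₀ (pow_ne_zero 2 (mul_ne_zero two_ne_zero hp0)) ?_
    linear_combination h
  have hyodd : Odd y := by
    have : Odd (y ^ 2) := ⟨p * m, by rw [hy]; ring⟩
    exact (Int.odd_pow' two_ne_zero).mp this
  obtain ⟨e, he, c, hc⟩ : ∃ e : ℤ, (e = 1 ∨ e = -1) ∧ (p : ℤ) ∣ y - e := by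
    have hdvd : (p : ℤ) ∣ (y - 1) * (y - -1) := ⟨2 * m, by linear_combination hy⟩
    rcases hpp.dvd_or_dvd hdvd with h | h
    exacts [⟨1, .inl rfl, h⟩, ⟨-1, .inr rfl, h⟩]
  have heodd : Odd e := by rcases he with rfl | rfl <;> decide
  have hceven : Even c := by
    have : Even ((p : ℤ) * c) := hc ▸ hyodd.sub_odd heodd
    exact (Int.even_mul.mp this).resolve_left (Int.not_even_iff_odd.mpr hpodd)
  obtain ⟨t, rfl⟩ := hceven
  exact ⟨t, e, he, by linear_combination 2 * p * hc⟩

/-- The bound on `k` in terms of the parameters `t`, `e` given by `exists_eq_of_eigenvalue_eq`. -/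
theorem lt_of_eigenvalue_param {p k b t e : ℤ} (hp : 5 ≤ p) (hk : k ≤ 4 * p ^ 3)
    (hb1 : -(2 * p) ≤ b) (hb2 : b ≤ 2 * p) (he : e = 1 ∨ e = -1)
    (hkt : k = 2 * p * (2 * p * t + e) + b)
    (hquad : b ^ 2 + b = 2 * p * t ^ 2 + 2 * e * t - 4 * p ^ 2 * t - 2 * e * p + 4 * p ^ 2) :
    2 * k < 8 * p ^ 2 + 6 * p := by
  by_contra! hbig
  have hbb : 0 ≤ b ^ 2 + b := by
    rcases le_or_gt 0 b with h | h <;> nlinarith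
  have hpe : -(2 * p) ≤ 2 * p * e ∧ 2 * p * e ≤ 2 * p := by
    rcases he with rfl | rfl <;> constructor <;> linarith
  have hp2 : 5 * p ≤ p ^ 2 := by nlinarith
  have ht1 : 1 ≤ t := by
    by_contra! h
    have : 0 ≤ p ^ 2 * -t := mul_nonneg (sq_nonneg _) (by linarith)
    linarith
  have htp : t ≤ p := by
    by_contra! h
    have : 0 ≤ p ^ 2 * (t - p - 1) := mul_nonneg (sq_nonneg _) (by linarith)
    linarith
  rcases ht1.eq_or_lt with rfl | ht2
  · rcases he with rfl | rfl
    · have : b ≤ 1 := by nlinarith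
      linarith
    · linarith
  · have hconv : 0 ≤ p * ((t - 2) * (p - t)) :=
      mul_nonneg (by positivity) (mul_nonneg (by linarith) (by linarith))
    have hmul : 0 ≤ (p ^ 2 - 2 * p) * (t - 2) := mul_nonneg (by linarith) (by linarith)
    rcases he with rfl | rfl <;> linarith

/-- For a nontrivial regular PDS in an Abelian group of order `8p^3` with
`Δ = 16p^2` and `k ≤ 4p^3`, `p ≥ 5` prime, we have `k ≤ 4p^2 + 3p - 1/2`. -/
theorem pds_delta_16p2_k_bound (p : ℕ) (hp : p.Prime) (hp5 : 5 ≤ p)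
    {G : Type*} [CommGroup G] [DecidableEq G] [Fintype G]
    (D : Finset G) (k l m : ℕ)
    (hPDS : IsPDS D (8 * p ^ 3) k l m) (hreg : IsRegularPDS D)
    (hnt : ¬ IsTrivialPDS D) (hk : k ≤ 4 * p ^ 3)
    (hΔ : ((l : ℤ) - m) ^ 2 + 4 * ((k : ℤ) - m) = 16 * p ^ 2) :
    2 * k ≤ 8 * p ^ 2 + 6 * p - 1 := by
  have hcount := hPDS.card_mul_pred hreg.2
  push_cast at hcount
  have hp5' : (5 : ℤ) ≤ p := by exact_mod_cast hp5
  have hk' : (k : ℤ) ≤ 4 * p ^ 3 := by exact_mod_cast hk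
  by_contra hlt
  have hbig : 8 * (p : ℤ) ^ 2 + 6 * p ≤ 2 * k := by
    have : 8 * p ^ 2 + 6 * p ≤ 2 * k := by omega
    exact_mod_cast this
  have hmk : (m : ℤ) ≤ k := by
    have hk1 : (0 : ℤ) < k - 1 := by nlinarith
    refine le_of_mul_le_mul_right ?_ hk1
    have hml : (m : ℤ) * (k - 1) ≤ m * (8 * p ^ 3 - 1 - k) :=
      mul_le_mul_of_nonneg_left (by linarith) (by positivity)
    have : (0 : ℤ) ≤ l * k := by positivity
    linarith
  obtain ⟨b, hb⟩ : Even ((l : ℤ) - m) := by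
    refine (Int.even_pow.mp (?_ : Even (((l : ℤ) - m) ^ 2))).1
    exact ⟨8 * p ^ 2 - 2 * (k - m), by linear_combination hΔ⟩
  have hl : (l : ℤ) = m + 2 * b := by linear_combination hb
  rw [hl] at hΔ hcount
  have hm : (m : ℤ) = b ^ 2 + k - 4 * p ^ 2 := by linarith
  obtain ⟨hb1, hb2⟩ : -(2 * (p : ℤ)) ≤ b ∧ b ≤ 2 * p :=
    abs_le_of_sq_le_sq' (by linarith) (by positivity)
  obtain ⟨t, e, he, hx⟩ := exists_eq_of_eigenvalue_eq hp (by omega)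
    (x := k - b) (m := m) (by linear_combination hcount - hm)
  have hkt : (k : ℤ) = 2 * p * (2 * p * t + e) + b := by linarith
  have hquad : b ^ 2 + b = 2 * p * t ^ 2 + 2 * e * t - 4 * p ^ 2 * t - 2 * e * p + 4 * p ^ 2 := by
    have he2 : e ^ 2 = 1 := by rcases he with rfl | rfl <;> norm_num
    refine mul_left_cancel₀ (by positivity : 8 * (p : ℤ) ^ 3 ≠ 0) ?_
    rw [hkt] at hcount hm
    rw [hm] at hcount
    linear_combination -hcount + 4 * p ^ 2 * he2
  exact (lt_of_eigenvalue_param hp5' hk' hb1 hb2 he hkt hquad).not_ge hbig
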